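/- arXiv:1407.1590 — 2 statements merged into one kernel-verified Lean document; each statement's English description precedes it below -/
import Mathlib

section
/- Let (A, m) be a two-dimensional Gorenstein local ring and I an m-primary ideal with minimal reduction Q such that I² = QI. Then I is a good ideal (i.e., Q : I = I) if and only if 2·ℓ_A(A/I) = e₀(I), where e₀(I) is the Hilbert–Samuel multiplicity of I. -/
open IsLocalRing

/-- An element `x` of `A` is integral over the ideal `I`: it satisfies an equation
`x^n + c₁ x^(n-1) + ⋯ + c_n = 0` with `cᵢ ∈ Iⁱ`. -/
def IsIntegralOverIdeal {A : Type*} [CommRing A] (I : Ideal A) (x : A) : Prop :=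
  ∃ (n : ℕ) (c : ℕ → A), 0 < n ∧ (∀ i ∈ Finset.Icc 1 n, c i ∈ I ^ i) ∧
    x ^ n + ∑ i ∈ Finset.Icc 1 n, c i * x ^ (n - i) = 0

/-- An ideal is integrally closed if it contains every element integral over it. -/
def Ideal.IsIntegrallyClosedIdeal {A : Type*} [CommRing A] (I : Ideal A) : Prop :=
  ∀ x, IsIntegralOverIdeal I x → x ∈ I

/-- `Q` is a reduction of `I`: `Q ⊆ I` and `I^(r+1) = Q I^r` for some `r`. -/
def IsReductionOf {A : Type*} [CommRing A] (Q I : Ideal A) : Prop :=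
  Q ≤ I ∧ ∃ r : ℕ, I ^ (r + 1) = Q * I ^ r

/-- A minimal reduction of an `m`-primary ideal in a local ring: a reduction
generated by `dim A` elements (a parameter ideal). -/
def IsMinimalReductionOf {A : Type*} [CommRing A] (Q I : Ideal A) : Prop :=
  IsReductionOf Q I ∧
    ∃ s : Finset A, Ideal.span (s : Set A) = Q ∧ (s.card : WithBot ℕ∞) = ringKrullDim A

/-- In a two-dimensional local ring, a minimal reduction is a two-generated
(parameter) reduction. -/
def IsMinimalReduction2 {A : Type*} [CommRing A] (Q I : Ideal A) : Prop :=
  IsReductionOf Q I ∧ ∃ f g : A, Q = Ideal.span {f, g}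

/-- The length of an `A`-module, i.e. the Krull dimension of its lattice of submodules. -/
noncomputable def moduleLength (A M : Type*) [CommRing A] [AddCommGroup M] [Module A M] :
    WithBot ℕ∞ :=
  Order.krullDim (Submodule A M)

/-- The minimal number of generators of an ideal. -/
noncomputable def mu {A : Type*} [CommRing A] (I : Ideal A) : ℕ :=
  sInf {n : ℕ | ∃ s : Finset A, s.card = n ∧ Ideal.span (s : Set A) = I}

/-- A Noetherian local ring is Cohen–Macaulay iff some system of parameters
is a regular sequence. -/
def IsCohenMacaulayLocalRing (A : Type*) [CommRing A] [IsLocalRing A] : Prop :=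
  ∃ rs : List A, (∀ r ∈ rs, r ∈ maximalIdeal A) ∧ RingTheory.Sequence.IsRegular A rs ∧
    (rs.length : WithBot ℕ∞) = ringKrullDim A

/-- A Noetherian local ring is Gorenstein iff it is Cohen–Macaulay and some
(equivalently, every) parameter ideal is irreducible. -/
def IsGorensteinLocalRing (A : Type*) [CommRing A] [IsLocalRing A] : Prop :=
  ∃ rs : List A, (∀ r ∈ rs, r ∈ maximalIdeal A) ∧ RingTheory.Sequence.IsRegular A rs ∧
    (rs.length : WithBot ℕ∞) = ringKrullDim A ∧ InfIrred (Ideal.ofList rs)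

/-- `I` has Hilbert–Samuel multiplicity `e` with respect to dimension `d`:
`ℓ_A(A/I^{n+1})` agrees for large `n` with a polynomial with leading term `(e/d!) n^d`. -/
def HasHSMultiplicity {A : Type*} [CommRing A] (I : Ideal A) (d e : ℕ) : Prop :=
  ∃ p : Polynomial ℚ, p.natDegree ≤ d ∧ p.coeff d * (Nat.factorial d : ℚ) = (e : ℚ) ∧
    ∀ᶠ n : ℕ in Filter.atTop, ∃ l : ℕ,
      moduleLength A (A ⧸ I ^ (n + 1)) = (l : WithBot ℕ∞) ∧
        (l : ℚ) = Polynomial.eval (n : ℚ) p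

/-- The pair `x, y` is a weakly regular sequence: `x` is a nonzerodivisor, and `y` is a
nonzerodivisor modulo `x`. -/
def IsWeaklyRegularPair {A : Type*} [CommRing A] (x y : A) : Prop :=
  (∀ a, x * a = 0 → a = 0) ∧ ∀ a, x ∣ y * a → x ∣ a

/-- The elements of `A ⧸ Q` killed by the maximal ideal form a vector space of dimension at most
one: any nonzero one of them generates all the others. -/
def HasCyclicSocle {A : Type*} [CommRing A] [IsLocalRing A] (Q : Ideal A) : Prop :=
  ∀ a b, (∀ t ∈ maximalIdeal A, t * a ∈ Q) → (∀ t ∈ maximalIdeal A, t * b ∈ Q) → b ∉ Q →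
    ∃ c, a - c * b ∈ Q

section RegularPair

variable {A : Type*} [CommRing A]

lemma isWeaklyRegularPair_of_isWeaklyRegular {x y : A}
    (h : RingTheory.Sequence.IsWeaklyRegular A [x, y]) : IsWeaklyRegularPair x y := by
  rw [RingTheory.Sequence.isWeaklyRegular_cons_iff] at h
  obtain ⟨hx, hy⟩ := h
  rw [RingTheory.Sequence.isWeaklyRegular_cons_iff] at hy
  refine ⟨fun a ha ↦ ?_, fun a ha ↦ ?_⟩
  · exact hx (by simpa using ha)
  · have key := hy.1 (a₁ := Submodule.Quotient.mk a) (a₂ := 0) (by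
      simp only [smul_zero]
      rw [← Submodule.Quotient.mk_smul, Submodule.Quotient.mk_eq_zero,
        Submodule.mem_smul_pointwise_iff_exists]
      obtain ⟨c, hc⟩ := ha
      exact ⟨c, trivial, by simp [hc]⟩)
    rw [Submodule.Quotient.mk_eq_zero, Submodule.mem_smul_pointwise_iff_exists] at key
    obtain ⟨c, -, hc⟩ := key
    exact ⟨c, by simpa using hc.symm⟩

lemma Ideal.eq_bot_of_le_smul_self [IsLocalRing A] [IsNoetherianRing A] {N : Ideal A} {x : A}
    (hx : x ∈ maximalIdeal A) (h : ∀ n ∈ N, ∃ n' ∈ N, n = x * n') : N = ⊥ := by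
  refine Submodule.eq_bot_of_le_smul_of_le_jacobson_bot (maximalIdeal A) N
    (IsNoetherian.noetherian N) (fun n hn ↦ ?_) (maximalIdeal_le_jacobson ⊥)
  obtain ⟨n', hn', rfl⟩ := h n hn
  exact Submodule.smul_mem_smul hx hn'

namespace IsWeaklyRegularPair

lemma swap [IsLocalRing A] [IsNoetherianRing A] {x y : A} (hx : x ∈ maximalIdeal A)
    (h : IsWeaklyRegularPair x y) : IsWeaklyRegularPair y x := by
  obtain ⟨h1, h2⟩ := h
  have hN : Submodule.colon (⊥ : Ideal A) {y} = ⊥ := by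
    refine Ideal.eq_bot_of_le_smul_self hx fun n hn ↦ ?_
    simp only [Submodule.mem_colon_singleton, smul_eq_mul, Ideal.mem_bot] at hn ⊢
    obtain ⟨c, rfl⟩ := h2 n (by rw [mul_comm, hn]; exact dvd_zero x)
    exact ⟨c, h1 _ (by linear_combination hn), rfl⟩
  refine ⟨fun a ha ↦ ?_, fun a ⟨b, hb⟩ ↦ ?_⟩
  · have : a ∈ Submodule.colon (⊥ : Ideal A) {y} := by
      simpa [Submodule.mem_colon_singleton, mul_comm] using ha
    simpa [hN] using this
  · obtain ⟨c, rfl⟩ := h2 b ⟨a, hb.symm⟩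
    exact ⟨c, sub_eq_zero.1 (h1 _ (by linear_combination hb))⟩

lemma pow {x y : A} (h : IsWeaklyRegularPair x y) (k : ℕ) :
    IsWeaklyRegularPair (x ^ k) (y ^ k) := by
  obtain ⟨h1, h2⟩ := h
  have hx : ∀ k a, x ^ k * a = 0 → a = 0 := by
    intro k
    induction k with
    | zero => simp
    | succ k ih => exact fun a ha ↦ ih a (h1 _ (by linear_combination ha))
  have hy : ∀ k a, x ^ k ∣ y * a → x ^ k ∣ a := by
    intro k
    induction k with
    | zero => simp
    | succ k ih =>
      rintro a ⟨b, hb⟩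
      obtain ⟨c, rfl⟩ := h2 a ⟨x ^ k * b, by rw [hb]; ring⟩
      have : y * c = x ^ k * b := sub_eq_zero.1 (h1 _ (by linear_combination hb))
      obtain ⟨d, rfl⟩ := ih c ⟨b, this⟩
      exact ⟨d, by ring⟩
  refine ⟨hx k, ?_⟩
  suffices ∀ l a, x ^ k ∣ y ^ l * a → x ^ k ∣ a from this k
  intro l
  induction l with
  | zero => simp
  | succ l ih => exact fun a ha ↦ ih a (hy k _ (by rwa [← mul_assoc, ← pow_succ']))

/-- Two generators of an ideal containing a weakly regular pair up to radical form themselves a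
weakly regular pair. -/
lemma of_mem_radical [IsLocalRing A] [IsNoetherianRing A] {x y f g : A}
    (h : IsWeaklyRegularPair x y) (hg : g ∈ maximalIdeal A)
    (hx : x ∈ (Ideal.span {f, g}).radical) (hy : y ∈ (Ideal.span {f, g}).radical) :
    IsWeaklyRegularPair f g := by
  obtain ⟨k, hk⟩ := hx
  obtain ⟨l, hl⟩ := hy
  obtain ⟨h1, h2⟩ := h.pow (k + l)
  obtain ⟨u, v, hx⟩ := Ideal.mem_span_pair.1
    (show x ^ (k + l) ∈ Ideal.span {f, g} by rw [pow_add]; exact Ideal.mul_mem_right _ _ hk)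
  obtain ⟨u', w, hy⟩ := Ideal.mem_span_pair.1
    (show y ^ (k + l) ∈ Ideal.span {f, g} by rw [pow_add]; exact Ideal.mul_mem_left _ _ hl)
  generalize x ^ (k + l) = X at *
  generalize y ^ (k + l) = Y at *
  have hN : Submodule.colon (⊥ : Ideal A) {f} = ⊥ := by
    refine Ideal.eq_bot_of_le_smul_self hg fun n hn ↦ ?_
    simp only [Submodule.mem_colon_singleton, smul_eq_mul, Ideal.mem_bot] at hn ⊢
    obtain ⟨n', hn'⟩ := h2 (v * n) ⟨w * n, by
      linear_combination (-v * n) * hy + w * n * hx + (u' * v - u * w) * hn⟩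
    have hf : n' * f = 0 := h1 _ (by linear_combination (-f) * hn' + v * hn)
    refine ⟨n', hf, sub_eq_zero.1 (h1 _ ?_)⟩
    linear_combination (-n) * hx + u * hn + g * hn'
  have hf : ∀ a, f * a = 0 → a = 0 := fun a ha ↦ by
    have : a ∈ Submodule.colon (⊥ : Ideal A) {f} := by
      simpa [Submodule.mem_colon_singleton, mul_comm] using ha
    simpa [hN] using this
  refine ⟨hf, fun a ⟨b, hb⟩ ↦ ?_⟩
  have hXa : X * a = f * (u * a + v * b) := by linear_combination (-a) * hx + v * hb
  have hYa : Y * a = f * (u' * a + w * b) := by linear_combination (-a) * hy + w * hb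
  have hXY : Y * (u * a + v * b) = X * (u' * a + w * b) :=
    sub_eq_zero.1 (hf _ (by linear_combination X * hYa - Y * hXa))
  obtain ⟨d, hd⟩ := h2 _ ⟨_, hXY⟩
  exact ⟨d, sub_eq_zero.1 (h1 _ (by linear_combination hXa + f * hd))⟩

end IsWeaklyRegularPair

end RegularPair

lemma Ideal.Quotient.smul_mk_span_singleton_eq_zero {A : Type*} [CommRing A]
    {x t a : A} :
    t • (Ideal.Quotient.mk (Ideal.span {x}) a) = 0 ↔ x ∣ t * a := by
  rw [Algebra.smul_def, Ideal.Quotient.algebraMap_eq, ← map_mul, Ideal.Quotient.eq_zero_iff_mem,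
    Ideal.mem_span_singleton]

section Socle

variable {A : Type*} [CommRing A] [IsLocalRing A]

lemma exists_isSMulRegular_mem_maximalIdeal [IsNoetherianRing A] {M : Type*} [AddCommGroup M]
    [Module A M] [Module.Finite A M] (hM : ∀ v : M, (∀ t ∈ maximalIdeal A, t • v = 0) → v = 0) :
    ∃ h ∈ maximalIdeal A, IsSMulRegular M h := by
  by_contra! hreg
  have hle : ∃ p ∈ associatedPrimes A M, maximalIdeal A ≤ p := by
    refine (Ideal.subset_union_prime_finite (associatedPrimes.finite A M) (f := id) ⊥ ⊥
      fun I hI _ _ ↦ IsAssociatedPrime.isPrime hI).mp ?_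
    have := biUnion_associatedPrimes_eq_compl_regular A M
    simp only [id]
    rw [this]
    exact fun r hr ↦ hreg r hr
  obtain ⟨p, hp, hmp⟩ := hle
  obtain ⟨hprime, v, hv⟩ := AssociatedPrimes.mem_iff.mp hp |> isAssociatedPrime_iff.mp
  have hv0 : v = 0 := hM v fun t ht ↦ by
    have := hmp ht
    rw [hv] at this
    simpa [Submodule.mem_colon_singleton] using this
  apply hprime.ne_top
  rw [hv, hv0, Ideal.eq_top_iff_one]
  simp [Submodule.mem_colon_singleton]

lemma exists_isWeaklyRegularPair_common [IsNoetherianRing A] {x y f g : A}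
    (hxy : IsWeaklyRegularPair x y) (hfg : IsWeaklyRegularPair f g)
    (hy : y ∈ maximalIdeal A) (hg : g ∈ maximalIdeal A) :
    ∃ h ∈ maximalIdeal A, IsWeaklyRegularPair x h ∧ IsWeaklyRegularPair f h := by
  obtain ⟨h, hm, hreg⟩ := exists_isSMulRegular_mem_maximalIdeal
    (M := (A ⧸ Ideal.span {x}) × (A ⧸ Ideal.span {f})) (by
      rintro ⟨v, w⟩ hvw
      obtain ⟨v, rfl⟩ := Ideal.Quotient.mk_surjective v
      obtain ⟨w, rfl⟩ := Ideal.Quotient.mk_surjective w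
      have h1 := hxy.2 v (Ideal.Quotient.smul_mk_span_singleton_eq_zero.1
        (Prod.ext_iff.1 (hvw y hy)).1)
      have h2 := hfg.2 w (Ideal.Quotient.smul_mk_span_singleton_eq_zero.1
        (Prod.ext_iff.1 (hvw g hg)).2)
      exact Prod.ext (Ideal.Quotient.eq_zero_iff_mem.2 (Ideal.mem_span_singleton.2 h1))
        (Ideal.Quotient.eq_zero_iff_mem.2 (Ideal.mem_span_singleton.2 h2)))
  refine ⟨h, hm, ⟨hxy.1, fun a ha ↦ ?_⟩, ⟨hfg.1, fun a ha ↦ ?_⟩⟩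
  · have := hreg (a₁ := (Ideal.Quotient.mk _ a, 0)) (a₂ := 0) (by
      simp only [Prod.smul_mk, smul_zero,
        Ideal.Quotient.smul_mk_span_singleton_eq_zero.2 ha, Prod.mk_zero_zero])
    simpa [Prod.ext_iff, Ideal.Quotient.eq_zero_iff_mem, Ideal.mem_span_singleton] using this
  · have := hreg (a₁ := (0, Ideal.Quotient.mk _ a)) (a₂ := 0) (by
      simp only [Prod.smul_mk, smul_zero,
        Ideal.Quotient.smul_mk_span_singleton_eq_zero.2 ha, Prod.mk_zero_zero])
    simpa [Prod.ext_iff, Ideal.Quotient.eq_zero_iff_mem, Ideal.mem_span_singleton] using this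

lemma InfIrred.hasCyclicSocle {P : Ideal A} (hP : InfIrred P) : HasCyclicSocle P := by
  intro a b ha hb hbP
  by_cases haP : a ∈ P
  · exact ⟨0, by simpa using haP⟩
  have hlt : ¬ (P ⊔ Ideal.span {a}) ⊓ (P ⊔ Ideal.span {b}) = P := by
    intro h
    rcases hP.2 h with h | h
    · exact haP (h ▸ Ideal.mem_sup_right (Ideal.mem_span_singleton_self a))
    · exact hbP (h ▸ Ideal.mem_sup_right (Ideal.mem_span_singleton_self b))
  have hle : ¬ (P ⊔ Ideal.span {a}) ⊓ (P ⊔ Ideal.span {b}) ≤ P :=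
    fun h ↦ hlt (le_antisymm h (le_inf le_sup_left le_sup_left))
  obtain ⟨z, ⟨hza, hzb⟩, hzP⟩ := SetLike.not_le_iff_exists.1 hle
  obtain ⟨p, hp, _, h1, rfl⟩ := Submodule.mem_sup.1 hza
  obtain ⟨q, hq, _, h2, hz⟩ := Submodule.mem_sup.1 hzb
  obtain ⟨r, rfl⟩ := Ideal.mem_span_singleton'.1 h1
  obtain ⟨s, rfl⟩ := Ideal.mem_span_singleton'.1 h2
  have hr : IsUnit r := by
    by_contra hr
    exact hzP (P.add_mem hp (ha r ((mem_maximalIdeal r).2 hr)))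
  obtain ⟨r', hr'⟩ := hr.exists_left_inv
  refine ⟨r' * s, ?_⟩
  have : a - r' * s * b = r' * (q - p) := by linear_combination (-a) * hr' - r' * hz
  rw [this]
  exact P.mul_mem_left _ (P.sub_mem hq hp)

/-- Replacing one generator by another one, both regular modulo the other generator, does not
affect the socle. -/
lemma HasCyclicSocle.replace {x h y : A} (hxm : x ∈ maximalIdeal A)
    (hx : ∀ a, y ∣ x * a → y ∣ a) (hh : ∀ a, y ∣ h * a → y ∣ a)
    (hS : HasCyclicSocle (Ideal.span {x, y})) : HasCyclicSocle (Ideal.span {h, y}) := by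
  have hmul : HasCyclicSocle (Ideal.span {x * h, y}) := by
    have lift : ∀ a, (∀ t ∈ maximalIdeal A, t * a ∈ Ideal.span {x * h, y}) →
        ∃ a' r, a = h * a' + y * r ∧ ∀ t ∈ maximalIdeal A, t * a' ∈ Ideal.span {x, y} := by
      intro a ha
      obtain ⟨a', q, hq⟩ := Ideal.mem_span_pair.1 (ha x hxm)
      obtain ⟨r, hr⟩ := hx (a - h * a') ⟨q, by linear_combination -hq⟩
      refine ⟨a', r, by linear_combination hr, fun t ht ↦ ?_⟩
      obtain ⟨p, q', hq'⟩ := Ideal.mem_span_pair.1 (ha t ht)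
      obtain ⟨d, hd⟩ := hh (t * a' - x * p) ⟨q' - t * r, by linear_combination (-t) * hr - hq'⟩
      exact Ideal.mem_span_pair.2 ⟨p, d, by linear_combination -hd⟩
    intro a b ha hb hbn
    obtain ⟨a', r, har, ha'⟩ := lift a ha
    obtain ⟨b', s, hbs, hb'⟩ := lift b hb
    obtain ⟨c, hc⟩ := hS a' b' ha' hb' fun hmem ↦ hbn (by
      obtain ⟨p, q, hpq⟩ := Ideal.mem_span_pair.1 hmem
      exact Ideal.mem_span_pair.2 ⟨p, h * q + s, by linear_combination h * hpq - hbs⟩)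
    obtain ⟨p, q, hpq⟩ := Ideal.mem_span_pair.1 hc
    exact ⟨c, Ideal.mem_span_pair.2
      ⟨p, h * q + r - c * s, by linear_combination h * hpq - har + c * hbs⟩⟩
  have up : ∀ z, z ∈ Ideal.span {h, y} → x * z ∈ Ideal.span {x * h, y} := by
    intro z hz
    obtain ⟨p, q, rfl⟩ := Ideal.mem_span_pair.1 hz
    exact Ideal.mem_span_pair.2 ⟨p, x * q, by ring⟩
  have down : ∀ z, x * z ∈ Ideal.span {x * h, y} → z ∈ Ideal.span {h, y} := by
    intro z hz
    obtain ⟨p, q, hpq⟩ := Ideal.mem_span_pair.1 hz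
    obtain ⟨d, hd⟩ := hx (z - p * h) ⟨q, by linear_combination -hpq⟩
    exact Ideal.mem_span_pair.2 ⟨p, d, by linear_combination -hd⟩
  intro a b ha hb hbn
  obtain ⟨c, hc⟩ := hmul (x * a) (x * b)
    (fun t ht ↦ by rw [mul_left_comm]; exact up _ (ha t ht))
    (fun t ht ↦ by rw [mul_left_comm]; exact up _ (hb t ht)) (fun hmem ↦ hbn (down _ hmem))
  exact ⟨c, down _ (by convert hc using 1; ring)⟩

lemma HasCyclicSocle.of_isWeaklyRegularPair [IsNoetherianRing A] {x y f g : A}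
    (hS : HasCyclicSocle (Ideal.span {x, y}))
    (hxy : IsWeaklyRegularPair x y) (hfg : IsWeaklyRegularPair f g)
    (hx : x ∈ maximalIdeal A) (hy : y ∈ maximalIdeal A)
    (hf : f ∈ maximalIdeal A) (hg : g ∈ maximalIdeal A) :
    HasCyclicSocle (Ideal.span {f, g}) := by
  obtain ⟨h, hm, hxh, hfh⟩ := exists_isWeaklyRegularPair_common hxy hfg hy hg
  rw [Set.pair_comm] at hS
  have hS₁ := hS.replace hy hxy.2 hxh.2
  rw [Set.pair_comm] at hS₁
  have hS₂ := hS₁.replace hx (hxh.swap hx).2 (hfh.swap hf).2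
  rw [Set.pair_comm] at hS₂ ⊢
  exact hS₂.replace hm hfh.2 hfg.2

end Socle

section Duality

lemma LinearMap.length_quotient_eq_add {R M M' : Type*} [Ring R] [AddCommGroup M] [Module R M]
    [AddCommGroup M'] [Module R M'] (φ : M' →ₗ[R] M) {N : Submodule R M} (h : N ≤ range φ) :
    Module.length R (M ⧸ N) =
      Module.length R (M' ⧸ N.comap φ) + Module.length R (M ⧸ range φ) := by
  refine Module.length_eq_add_of_exact (Submodule.mapQ _ N φ le_rfl)
    (Submodule.factor h) ?_ (Submodule.factor_surjective h) ?_
  · rw [← LinearMap.ker_eq_bot, Submodule.ker_mapQ]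
    exact Submodule.mkQ_map_self _
  · rw [LinearMap.exact_iff, Submodule.range_mapQ]
    ext z
    obtain ⟨z, rfl⟩ := N.mkQ_surjective z
    constructor
    · intro hz
      exact ⟨z, by simpa using hz, rfl⟩
    · rintro ⟨p, hp, hpz⟩
      rw [← hpz]
      simpa using hp

lemma Submodule.length_quotient_of_le {R M : Type*} [Ring R] [AddCommGroup M] [Module R M]
    {N P : Submodule R M} (h : N ≤ P) :
    Module.length R (M ⧸ N) =
      Module.length R (P ⧸ N.comap P.subtype) + Module.length R (M ⧸ P) := by
  have := P.subtype.length_quotient_eq_add (N := N) (by rwa [range_subtype])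
  rwa [range_subtype] at this

lemma Submodule.eq_of_le_of_length_quotient_eq {R M : Type*} [Ring R] [AddCommGroup M] [Module R M]
    {N P : Submodule R M} (h : N ≤ P) (hN : Module.length R (M ⧸ N) ≠ ⊤)
    (heq : Module.length R (M ⧸ N) = Module.length R (M ⧸ P)) : N = P := by
  have hsum := Submodule.length_quotient_of_le h
  rw [← heq] at hsum
  have hzero : (0 : ℕ∞) = _ := WithTop.add_right_cancel hN ((zero_add _).trans hsum)
  rw [eq_comm, Module.length_eq_zero_iff, Submodule.Quotient.subsingleton_iff,
    Submodule.comap_subtype_eq_top] at hzero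
  exact le_antisymm h hzero

lemma CovBy.length_quotient {R M : Type*} [Ring R] [AddCommGroup M] [Module R M]
    {N P : Submodule R M} (h : N ⋖ P) :
    Module.length R (M ⧸ N) = Module.length R (M ⧸ P) + 1 := by
  have := (covBy_iff_quot_is_simple h.le).1 h
  rw [Submodule.length_quotient_of_le h.le, Module.length_eq_one, add_comm]

variable {A : Type*} [CommRing A] [IsLocalRing A]

lemma CovBy.exists_eq_sup_span_singleton {J J' : Ideal A} (h : J ⋖ J') :
    ∃ x, J' = J ⊔ Ideal.span {x} ∧ ∀ t ∈ maximalIdeal A, t * x ∈ J := by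
  obtain ⟨x, hx', hx⟩ := SetLike.exists_of_lt h.lt
  have hsup : ∀ z ∈ J', z ∉ J → J ⊔ Ideal.span {z} = J' := fun z hz' hz ↦
    (h.eq_or_eq le_sup_left (sup_le h.le ((Ideal.span_singleton_le_iff_mem _).2 hz'))).resolve_left
      fun heq ↦ hz (heq ▸ Ideal.mem_sup_right (Ideal.mem_span_singleton_self z))
  refine ⟨x, (hsup x hx' hx).symm, fun t ht ↦ ?_⟩
  by_contra htx
  have hmem : x ∈ J ⊔ Ideal.span {t * x} := by
    rwa [hsup (t * x) (J'.mul_mem_left t hx') htx]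
  obtain ⟨j, hj, _, hs, hsum⟩ := Submodule.mem_sup.1 hmem
  obtain ⟨s, rfl⟩ := Ideal.mem_span_singleton'.1 hs
  have hunit : IsUnit (1 - s * t) :=
    isUnit_one_sub_self_of_mem_nonunits _ ((maximalIdeal A).mul_mem_left s ht)
  refine hx ((Ideal.unit_mul_mem_iff_mem J hunit).1 ?_)
  convert hj using 1
  linear_combination -hsum

lemma HasCyclicSocle.length_quotient_colon_le {Q J J' : Ideal A} (hS : HasCyclicSocle Q)
    (h : J ⋖ J') :
    Module.length A (A ⧸ Q.colon J') ≤ Module.length A (A ⧸ Q.colon J) + 1 := by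
  obtain ⟨x, hx, hmx⟩ := h.exists_eq_sup_span_singleton
  have hle : Q.colon J' ≤ Q.colon J := Submodule.colon_mono le_rfl h.le
  have hmem : ∀ y, y ∈ Q.colon J → y * x ∈ Q → y ∈ Q.colon J' := by
    intro y hy hyx
    rw [Submodule.mem_colon] at hy ⊢
    intro z hz
    rw [hx] at hz
    obtain ⟨j, hj, _, hs, rfl⟩ := Submodule.mem_sup.1 hz
    obtain ⟨s, rfl⟩ := Ideal.mem_span_singleton'.1 hs
    rw [smul_add]
    refine Q.add_mem (hy j hj) ?_
    rw [smul_eq_mul, mul_left_comm]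
    exact Q.mul_mem_left s hyx
  have hsoc : ∀ y ∈ Q.colon J, ∀ t ∈ maximalIdeal A, t * (y * x) ∈ Q := by
    intro y hy t ht
    rw [mul_left_comm]
    exact Submodule.mem_colon.1 hy _ (hmx t ht)
  rcases hle.eq_or_lt with heq | hlt
  · rw [heq]
    exact le_self_add
  refine (CovBy.length_quotient ⟨hlt, fun C hC hC' ↦ ?_⟩).le
  obtain ⟨b, hbC, hb⟩ := SetLike.exists_of_lt hC
  refine hC'.not_ge fun a ha ↦ ?_
  obtain ⟨c, hc⟩ := hS (a * x) (b * x) (hsoc a ha) (hsoc b (hC'.le hbC))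
    fun hbx ↦ hb (hmem b (hC'.le hbC) hbx)
  have hdiff : a - c * b ∈ Q.colon J' :=
    hmem _ (Ideal.sub_mem _ ha (Ideal.mul_mem_left _ c (hC'.le hbC)))
      (by convert hc using 1; ring)
  have := C.add_mem (hC.le hdiff) (Ideal.mul_mem_left C c hbC)
  rwa [sub_add_cancel] at this

lemma HasCyclicSocle.length_add_length_le [IsNoetherianRing A] {Q : Ideal A}
    (hS : HasCyclicSocle Q) {J J' : Ideal A} (h : J ≤ J') (hJ : Module.length A (A ⧸ J) ≠ ⊤) :
    Module.length A (A ⧸ J') + Module.length A (A ⧸ Q.colon J') ≤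
      Module.length A (A ⧸ J) + Module.length A (A ⧸ Q.colon J) := by
  have hfin : ∀ {K : Ideal A}, J ≤ K → Module.length A (A ⧸ K) ≠ ⊤ := fun hK ↦
    ((Module.length_le_of_surjective _ (Submodule.factor_surjective hK)).trans_lt hJ.lt_top).ne
  obtain ⟨n, hn⟩ := ENat.ne_top_iff_exists.1 hJ
  obtain ⟨k, hk⟩ : ∃ k : ℕ, (n : ℕ∞) ≤ Module.length A (A ⧸ J') + k := ⟨n, le_add_self⟩
  induction k generalizing J' with
  | zero =>
    rcases h.eq_or_lt with rfl | hlt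
    · rfl
    obtain ⟨K, hJK, hK⟩ := hlt.exists_le_covby
    have h1 := (Module.length_le_of_surjective _ (Submodule.factor_surjective hJK))
    rw [← hn, hK.length_quotient] at h1
    obtain ⟨m, hm⟩ := ENat.ne_top_iff_exists.1 (hfin h)
    rw [← hm] at h1 hk
    norm_cast at h1 hk
    omega
  | succ k ih =>
    rcases h.eq_or_lt with rfl | hlt
    · rfl
    obtain ⟨K, hJK, hK⟩ := hlt.exists_le_covby
    have hlen := hK.length_quotient
    refine le_trans ?_ (ih hJK (by rw [hlen]; push_cast at hk; rwa [add_assoc, add_comm 1]))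
    rw [hlen, add_assoc, add_comm 1]
    gcongr
    exact hS.length_quotient_colon_le hK

/-- Gorenstein duality for an ideal whose residue ring has finite length and cyclic socle. -/
lemma HasCyclicSocle.length_add_length_colon [IsNoetherianRing A] {Q J : Ideal A}
    (hS : HasCyclicSocle Q) (hQ : Module.length A (A ⧸ Q) ≠ ⊤) (h : Q ≤ J) :
    Module.length A (A ⧸ J) + Module.length A (A ⧸ Q.colon J) = Module.length A (A ⧸ Q) := by
  have htop : Q.colon (Q : Set A) = ⊤ :=
    (Ideal.eq_top_iff_one _).2 (Submodule.mem_colon.2 fun s hs ↦ by simpa using hs)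
  have hself : Q.colon ((⊤ : Ideal A) : Set A) = Q := by
    refine le_antisymm (fun z hz ↦ ?_) fun z hz ↦ Submodule.mem_colon.2 fun s _ ↦ ?_
    · simpa using Submodule.mem_colon.1 hz 1 trivial
    · exact Q.mul_mem_right s hz
  refine le_antisymm ?_ ?_
  · have := hS.length_add_length_le h hQ
    rwa [htop, Module.length_eq_zero (M := A ⧸ (⊤ : Ideal A)), add_zero] at this
  · have hJ : Module.length A (A ⧸ J) ≠ ⊤ :=
      ((Module.length_le_of_surjective _ (Submodule.factor_surjective h)).trans_lt hQ.lt_top).ne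
    have := hS.length_add_length_le (le_top : J ≤ ⊤) hJ
    rwa [hself, Module.length_eq_zero (M := A ⧸ (⊤ : Ideal A)), zero_add] at this

lemma Ideal.length_quotient_ne_top_of_radical_eq [IsNoetherianRing A] {Q : Ideal A}
    (h : Q.radical = maximalIdeal A) : Module.length A (A ⧸ Q) ≠ ⊤ := by
  have hQ : Q ≠ ⊤ := by
    rintro rfl
    exact (maximalIdeal.isMaximal A).ne_top (by rw [← h, Ideal.radical_top])
  have := Ideal.Quotient.nontrivial_iff.2 hQ
  have : IsLocalRing (A ⧸ Q) := .of_surjective' _ Ideal.Quotient.mk_surjective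
  have hart : IsArtinianRing (A ⧸ Q) := by
    rw [isArtinianRing_iff_isNilpotent_maximalIdeal,
      Ideal.FG.isNilpotent_iff_le_nilradical (IsNoetherian.noetherian _)]
    intro z hz
    obtain ⟨z, rfl⟩ := Ideal.Quotient.mk_surjective z
    have hzm : z ∈ maximalIdeal A := fun hu ↦ hz (hu.map _)
    rw [← h] at hzm
    obtain ⟨k, hk⟩ := hzm
    exact ⟨k, by rw [← map_pow]; exact Ideal.Quotient.eq_zero_iff_mem.2 hk⟩
  rw [Module.length_eq_of_surjective (R := A ⧸ Q) Ideal.Quotient.mk_surjective]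
  exact Module.length_ne_top

end Duality

section Powers

variable {A : Type*} [CommRing A]

lemma Ideal.span_pair_pow_succ_mul (f g : A) (J : Ideal A) (n : ℕ) :
    span {f, g} ^ (n + 1) * J = span {f} * (span {f, g} ^ n * J) ⊔ span {g ^ (n + 1)} * J := by
  have hsup : span {f, g} = span {f} ⊔ span {g} := by
    rw [← span_union, Set.singleton_union]
  induction n with
  | zero => simp [hsup, sup_mul]
  | succ n ih =>
    have hg : span {g} * (span {f, g} ^ (n + 1) * J) ≤
        span {f} * (span {f, g} ^ (n + 1) * J) ⊔ span {g ^ (n + 1 + 1)} * J := by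
      nth_rw 1 [ih]
      rw [mul_sup, ← mul_assoc (span {g}) (span {g ^ (n + 1)}), span_singleton_mul_span_singleton,
        ← pow_succ', mul_left_comm]
      refine sup_le_sup_right (mul_mono_right ?_) _
      rw [← mul_assoc, pow_succ']
      exact mul_mono_left (mul_mono_left (by rw [hsup]; exact le_sup_right))
    refine le_antisymm ?_ (sup_le ?_ ?_)
    · rw [pow_succ' (span {f, g}) (n + 1), mul_assoc]
      nth_rw 1 [hsup]
      rw [sup_mul]
      exact sup_le le_sup_left hg
    · rw [pow_succ' (span {f, g}) (n + 1), mul_assoc]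
      exact mul_mono_left (by rw [hsup]; exact le_sup_left)
    · rw [← span_singleton_pow]
      exact mul_mono_left (pow_right_mono (by rw [hsup]; exact le_sup_right) _)

/-- Evaluation at `(f, g)` of the binary form of degree `n` with given coefficients. -/
def evalBinaryForm (f g : A) (n : ℕ) : (Fin (n + 1) → A) →ₗ[A] A :=
  Fintype.linearCombination A fun i : Fin (n + 1) ↦ f ^ (i : ℕ) * g ^ (n - i)

lemma evalBinaryForm_succ (f g : A) (n : ℕ) (a : Fin (n + 2) → A) :
    evalBinaryForm f g (n + 1) a = a 0 * g ^ (n + 1) + f * evalBinaryForm f g n (Fin.tail a) := by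
  simp only [evalBinaryForm, Fintype.linearCombination_apply, smul_eq_mul, Finset.mul_sum]
  rw [Fin.sum_univ_succ]
  congr 1
  · simp
  · refine Finset.sum_congr rfl fun i _ ↦ ?_
    simp only [Fin.val_succ, Nat.reduceSubDiff, Fin.tail]
    ring

lemma map_evalBinaryForm_pi (f g : A) (J : Ideal A) (n : ℕ) :
    (Submodule.pi Set.univ fun _ ↦ J).map (evalBinaryForm f g n) =
      Ideal.span {f, g} ^ n * J := by
  induction n with
  | zero =>
    ext z
    constructor
    · rintro ⟨a, ha, rfl⟩
      simpa [evalBinaryForm, Fintype.linearCombination_apply] using ha 0 trivial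
    · intro hz
      exact ⟨fun _ ↦ z, fun _ _ ↦ by simpa using hz, by
        simp [evalBinaryForm, Fintype.linearCombination_apply]⟩
  | succ n ih =>
    rw [Ideal.span_pair_pow_succ_mul, ← ih]
    ext z
    rw [Submodule.mem_sup]
    constructor
    · rintro ⟨a, ha, rfl⟩
      refine ⟨_, Ideal.mem_span_singleton_mul.2 ⟨_, ⟨Fin.tail a, fun i _ ↦ ha i.succ trivial, rfl⟩,
        rfl⟩, _, Ideal.mem_span_singleton_mul.2 ⟨a 0, ha 0 trivial, rfl⟩, ?_⟩
      rw [evalBinaryForm_succ]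
      ring
    · rintro ⟨_, hu, _, hv, rfl⟩
      obtain ⟨_, ⟨a, ha, rfl⟩, rfl⟩ := Ideal.mem_span_singleton_mul.1 hu
      obtain ⟨b, hb, rfl⟩ := Ideal.mem_span_singleton_mul.1 hv
      refine ⟨Fin.cons b a, fun i _ ↦ ?_, ?_⟩
      · cases i using Fin.cases with
        | zero => exact hb
        | succ i => exact ha i trivial
      · rw [evalBinaryForm_succ, Fin.tail_cons, Fin.cons_zero]
        ring

/-- A regular sequence of length two is quasi-regular. -/
lemma IsWeaklyRegularPair.mem_span_of_evalBinaryForm_eq_zero {f g : A}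
    (h : IsWeaklyRegularPair f g) {n : ℕ} {a : Fin (n + 1) → A}
    (ha : evalBinaryForm f g n a = 0) (i : Fin (n + 1)) : a i ∈ Ideal.span {f, g} := by
  induction n with
  | zero =>
    obtain rfl : i = 0 := Fin.fin_one_eq_zero i
    have : a 0 = 0 := by simpa [evalBinaryForm, Fintype.linearCombination_apply] using ha
    exact this ▸ zero_mem _
  | succ n ih =>
    rw [evalBinaryForm_succ] at ha
    have hdvd : ∀ k b, f ∣ b * g ^ k → f ∣ b := by
      intro k
      induction k with
      | zero => simp
      | succ k ihk => exact fun b hb ↦ ihk b (h.2 _ (by convert hb using 1; ring))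
    obtain ⟨c, hc⟩ := hdvd (n + 1) (a 0) ⟨-evalBinaryForm f g n (Fin.tail a), by
      linear_combination ha⟩
    have key := ih (a := Fin.tail a + Pi.single 0 (c * g)) (by
      rw [map_add, evalBinaryForm, Fintype.linearCombination_apply_single, ← evalBinaryForm]
      refine h.1 _ ?_
      simp only [smul_eq_mul, Fin.val_zero, pow_zero, tsub_zero]
      linear_combination ha - g ^ (n + 1) * hc)
    cases i using Fin.cases with
    | zero => exact Ideal.mem_span_pair.2 ⟨c, 0, by linear_combination -hc⟩
    | succ i =>
      have hs : (Pi.single 0 (c * g) : Fin (n + 1) → A) i ∈ Ideal.span {f, g} := by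
        rw [Pi.single_apply]
        split_ifs
        · exact Ideal.mul_mem_left _ _ (Ideal.subset_span (by simp))
        · exact zero_mem _
      exact ((Ideal.span {f, g}).add_mem_iff_left hs).1 (key i)

lemma IsWeaklyRegularPair.length_quotient_pow_mul {f g : A} (h : IsWeaklyRegularPair f g)
    {J : Ideal A} (hJ : Ideal.span {f, g} ≤ J) (n : ℕ) :
    Module.length A (A ⧸ Ideal.span {f, g} ^ n * J) =
      (n + 1) * Module.length A (A ⧸ J) + Module.length A (A ⧸ Ideal.span {f, g} ^ n) := by
  let P : Submodule A (Fin (n + 1) → A) := Submodule.pi Set.univ fun _ ↦ J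
  have hP : P.map (evalBinaryForm f g n) = Ideal.span {f, g} ^ n * J :=
    map_evalBinaryForm_pi f g J n
  have hrange : LinearMap.range (evalBinaryForm f g n) = Ideal.span {f, g} ^ n := by
    have := map_evalBinaryForm_pi f g ⊤ n
    rwa [Submodule.pi_top, Submodule.map_top, Ideal.mul_top] at this
  have hker : LinearMap.ker (evalBinaryForm f g n) ≤ P := fun a ha i _ ↦
    hJ (h.mem_span_of_evalBinaryForm_eq_zero ha i)
  have hcomap : P = Submodule.comap (evalBinaryForm f g n) (Ideal.span {f, g} ^ n * J) := by
    rw [← hP, Submodule.comap_map_eq, sup_eq_left.2 hker]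
  have hlen : Module.length A ((Fin (n + 1) → A) ⧸ P) = (n + 1) * Module.length A (A ⧸ J) := by
    rw [(Submodule.quotientPi fun _ : Fin (n + 1) ↦ J).length_eq]
    simp
  have := (evalBinaryForm f g n).length_quotient_eq_add (N := Ideal.span {f, g} ^ n * J)
    (by rw [hrange]; exact Ideal.mul_le_left)
  rwa [← hcomap, hlen, hrange] at this

lemma IsWeaklyRegularPair.length_quotient_pow {f g : A} (h : IsWeaklyRegularPair f g) (n : ℕ) :
    Module.length A (A ⧸ Ideal.span {f, g} ^ n) =
      (n + 1).choose 2 * Module.length A (A ⧸ Ideal.span {f, g}) := by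
  induction n with
  | zero =>
    rw [pow_zero, Ideal.one_eq_top]
    simp [Module.length_eq_zero]
  | succ n ih =>
    rw [pow_succ, h.length_quotient_pow_mul le_rfl, ih, ← add_mul, Nat.choose_succ_succ' (n + 1) 1,
      Nat.choose_one_right]
    push_cast
    rfl

end Powers

section Multiplicity

variable {A : Type*} [CommRing A]

lemma moduleLength_eq_natCast_iff {M : Type*} [AddCommGroup M] [Module A M] {l : ℕ} :
    moduleLength A M = l ↔ Module.length A M = l := by
  rw [moduleLength, ← Module.coe_length]
  exact_mod_cast Iff.rfl

/-- If the Hilbert–Samuel function is `(n + 1).choose 2 * e + (n + 1) * l`, then the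
multiplicity is `e`. -/
lemma hasHSMultiplicity_two_iff {I : Ideal A} {e l m : ℕ}
    (h : ∀ n : ℕ, Module.length A (A ⧸ I ^ (n + 1)) = ((n + 1) * l + (n + 1).choose 2 * e : ℕ)) :
    HasHSMultiplicity I 2 m ↔ m = e := by
  open Polynomial in
  let p : ℚ[X] := C (e / 2 : ℚ) * X ^ 2 + C (e / 2 + l : ℚ) * X + C (l : ℚ)
  have hp : ∀ n : ℕ, (((n + 1) * l + (n + 1).choose 2 * e : ℕ) : ℚ) = p.eval (n : ℚ) := by
    intro n
    simp only [p, Polynomial.eval_add, Polynomial.eval_mul, Polynomial.eval_C,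
      Polynomial.eval_pow, Polynomial.eval_X]
    push_cast [Nat.cast_choose_two]
    ring
  have hcoeff : p.coeff 2 * (Nat.factorial 2 : ℚ) = e := by
    simp [p, Nat.factorial]
  constructor
  · rintro ⟨q, -, hq, hev⟩
    obtain ⟨N, hN⟩ := Filter.eventually_atTop.1 hev
    have hqp : q = p := by
      refine Polynomial.eq_of_infinite_eval_eq q p (Set.infinite_of_injective_forall_mem
        (f := fun k : ℕ ↦ ((N + k : ℕ) : ℚ)) (fun a b hab ↦ ?_) fun k ↦ ?_)
      · exact Nat.add_left_cancel (Nat.cast_injective hab)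
      · obtain ⟨L, hL, hLq⟩ := hN (N + k) (Nat.le_add_right N k)
        rw [moduleLength_eq_natCast_iff, h, Nat.cast_inj] at hL
        rw [Set.mem_ofPred_eq, ← hp, hL, hLq]
    rw [hqp, hcoeff] at hq
    exact_mod_cast hq.symm
  · rintro rfl
    exact ⟨p, Polynomial.natDegree_quadratic_le, hcoeff, .of_forall fun n ↦
      ⟨_, moduleLength_eq_natCast_iff.2 (h n), hp n⟩⟩

end Multiplicity

lemma Ideal.pow_succ_eq_pow_mul_of_sq_eq {A : Type*} [CommRing A] {I Q : Ideal A}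
    (h : I ^ 2 = Q * I) (n : ℕ) : I ^ (n + 1) = Q ^ n * I := by
  induction n with
  | zero => simp
  | succ n ih => rw [pow_succ, ih, mul_assoc, ← sq, h, ← mul_assoc, ← pow_succ]

/-- Let `(A, m)` be a two-dimensional Gorenstein local ring and `I`
an `m`-primary ideal with minimal reduction `Q` such that `I² = QI`. Then `I` is a
good ideal (`Q : I = I`) iff `2 ℓ_A(A/I) = e₀(I)`, the Hilbert–Samuel multiplicity. -/
theorem statement2 {A : Type*} [CommRing A] [IsLocalRing A] [IsNoetherianRing A]
    (hGor : IsGorensteinLocalRing A) (hdim : ringKrullDim A = 2)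
    (I Q : Ideal A) (hprim : I.radical = maximalIdeal A)
    (hQ : IsMinimalReduction2 Q I) (hstable : I ^ 2 = Q * I) :
    Q.colon I = I ↔
      ∃ l : ℕ, moduleLength A (A ⧸ I) = (l : WithBot ℕ∞) ∧ HasHSMultiplicity I 2 (2 * l) := by
  obtain ⟨⟨hQI, r, hr⟩, f, g, rfl⟩ := hQ
  have hradQ : (Ideal.span {f, g}).radical = maximalIdeal A := by
    refine le_antisymm (hprim ▸ Ideal.radical_mono hQI) ?_
    rw [← hprim, ← Ideal.radical_pow I r.succ_ne_zero, hr]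
    exact Ideal.radical_mono Ideal.mul_le_left
  have hQm : Ideal.span {f, g} ≤ maximalIdeal A := hradQ ▸ Ideal.le_radical
  have hf : f ∈ maximalIdeal A := hQm (Ideal.subset_span (by simp))
  have hg : g ∈ maximalIdeal A := hQm (Ideal.subset_span (by simp))
  obtain ⟨rs, hrs, hreg, hlen, hirr⟩ := hGor
  rw [hdim] at hlen
  obtain ⟨x, y, rfl⟩ := List.length_eq_two.1 (show rs.length = 2 by exact_mod_cast hlen)
  have hx : x ∈ maximalIdeal A := hrs x (by simp)
  have hy : y ∈ maximalIdeal A := hrs y (by simp)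
  have hxy := isWeaklyRegularPair_of_isWeaklyRegular hreg.toIsWeaklyRegular
  have hfg : IsWeaklyRegularPair f g :=
    hxy.of_mem_radical hg (by rwa [hradQ]) (by rwa [hradQ])
  have hspan : Ideal.ofList [x, y] = Ideal.span {x, y} := by
    rw [Ideal.ofList]
    congr 1
    ext
    simp
  have hsoc : HasCyclicSocle (Ideal.span {f, g}) :=
    (hspan ▸ hirr.hasCyclicSocle).of_isWeaklyRegularPair hxy hfg hx hy hf hg
  have hdual := hsoc.length_add_length_colon
    (Ideal.length_quotient_ne_top_of_radical_eq hradQ) hQI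
  obtain ⟨l, hl⟩ := ENat.ne_top_iff_exists.1 (Ideal.length_quotient_ne_top_of_radical_eq hprim)
  obtain ⟨e, he⟩ := ENat.ne_top_iff_exists.1 (Ideal.length_quotient_ne_top_of_radical_eq hradQ)
  have hmult : ∀ {m : ℕ}, HasHSMultiplicity I 2 m ↔ m = e := by
    refine hasHSMultiplicity_two_iff (l := l) fun n ↦ ?_
    rw [Ideal.pow_succ_eq_pow_mul_of_sq_eq hstable, hfg.length_quotient_pow_mul hQI,
      hfg.length_quotient_pow, ← hl, ← he]
    push_cast
    rfl
  have hle : I ≤ (Ideal.span {f, g}).colon I := fun a ha ↦ Submodule.mem_colon.2 fun s hs ↦ by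
    have : a * s ∈ I ^ 2 := sq I ▸ Ideal.mul_mem_mul ha hs
    rw [hstable] at this
    exact Ideal.mul_le_left this
  constructor
  · intro hgood
    refine ⟨l, moduleLength_eq_natCast_iff.2 hl.symm, hmult.2 ?_⟩
    rw [hgood, ← hl, ← he] at hdual
    norm_cast at hdual
    omega
  · rintro ⟨l', hl', hm⟩
    rw [moduleLength_eq_natCast_iff, ← hl, Nat.cast_inj] at hl'
    subst hl'
    have h2 := hmult.1 hm
    rw [← hl, ← he, ← h2, two_mul, Nat.cast_add] at hdual
    exact (Submodule.eq_of_le_of_length_quotient_eq hle (by rw [← hl]; exact ENat.natCast_ne_top l)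
      (by rw [← hl]; exact (WithTop.add_left_cancel (ENat.natCast_ne_top l) hdual).symm)).symm
end

section
/- Let A = k[[x,y,z]]/(x² + y³ + z⁶) over an algebraically closed field k of characteristic 0. Then I = (x, y, z²) is an Ulrich ideal of colength 2, with minimal reduction Q = (y, z²): that is, I² = QI, ℓ_A(A/I) = 2, and ℓ_A(A/Q) = 4. -/
open IsLocalRing

/-- Adjoining to an ideal `K` one new element `g` that is multiplied into `K` by a maximal ideal
lowers the colength by exactly one. -/
theorem Ideal.length_quotient_span_insert {A : Type*} [CommRing A] (m : Ideal A) [m.IsMaximal]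
    (S : Set A) (g : A) (hg : g ∉ Ideal.span S) (hm : m * Ideal.span {g} ≤ Ideal.span S) :
    Module.length A (A ⧸ Ideal.span S) = 1 + Module.length A (A ⧸ Ideal.span (insert g S)) := by
  have hker : LinearMap.ker (LinearMap.toSpanSingleton A (A ⧸ Ideal.span S)
      (Submodule.Quotient.mk g)) = m := by
    refine (‹m.IsMaximal›.eq_of_le ?_ ?_).symm
    · intro h
      have h1 : (1 : A) ∈ LinearMap.ker (LinearMap.toSpanSingleton A (A ⧸ Ideal.span S)
        (Submodule.Quotient.mk g)) := h ▸ Submodule.mem_top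
      rw [LinearMap.mem_ker, LinearMap.toSpanSingleton_apply, one_smul,
        Submodule.Quotient.mk_eq_zero] at h1
      exact hg h1
    · intro a ha
      rw [LinearMap.mem_ker, LinearMap.toSpanSingleton_apply, ← Submodule.Quotient.mk_smul,
        Submodule.Quotient.mk_eq_zero]
      exact hm (Ideal.mul_mem_mul ha (Ideal.mem_span_singleton_self g))
  have hle : Ideal.span S ≤ Ideal.span (insert g S) := Ideal.span_mono (Set.subset_insert g S)
  have : IsSimpleModule A (A ⧸ m) := isSimpleModule_iff_isCoatom.mpr ‹m.IsMaximal›.out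
  rw [← Module.length_eq_one A (A ⧸ m)]
  refine Module.length_eq_add_of_exact (m.liftQ _ hker.ge) (Submodule.factor hle) ?_
    (Submodule.factor_surjective hle) ?_
  · rw [← LinearMap.ker_eq_bot]
    exact Submodule.ker_liftQ_eq_bot _ _ _ hker.le
  · rw [LinearMap.exact_iff, Submodule.range_liftQ, LinearMap.range_toSpanSingleton]
    ext q
    obtain ⟨a, rfl⟩ := Submodule.Quotient.mk_surjective _ q
    rw [LinearMap.mem_ker, ← Submodule.mkQ_apply, Submodule.factor_mk, Submodule.mkQ_apply,
      Submodule.mkQ_apply, Submodule.Quotient.mk_eq_zero, Submodule.mem_span_singleton]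
    constructor
    · intro ha
      obtain ⟨b, c, hc, rfl⟩ := Ideal.mem_span_insert.mp ha
      refine ⟨b, ?_⟩
      rw [← Submodule.Quotient.mk_smul, eq_comm, Submodule.Quotient.eq]
      simpa using hc
    · rintro ⟨b, hb⟩
      rw [← Submodule.Quotient.mk_smul, eq_comm, Submodule.Quotient.eq] at hb
      exact Ideal.mem_span_insert.mpr ⟨b, _, hb, by simp⟩

namespace MvPowerSeries

/-- A coefficient that vanishes on all multiples of the generators vanishes on the ideal. -/
theorem coeff_eq_zero_of_mem_span {σ R : Type*} [CommRing R] {S : Set (MvPowerSeries σ R)}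
    (d : σ →₀ ℕ) (h : ∀ g ∈ S, ∀ a, coeff d (a * g) = 0) {p : MvPowerSeries σ R}
    (hp : p ∈ Ideal.span S) : coeff d p = 0 := by
  rw [← mul_one p, mul_comm]
  generalize (1 : MvPowerSeries σ R) = b
  induction hp using Submodule.span_induction generalizing b with
  | mem g hg => exact h g hg b
  | zero => simp
  | add p q _ _ ihp ihq => rw [mul_add, map_add, ihp, ihq, add_zero]
  | smul a p _ ih => rw [smul_eq_mul, ← mul_assoc, ih]

theorem coeff_mul_X_pow_eq_zero {σ R : Type*} [CommRing R] (d : σ →₀ ℕ) (s : σ) (n : ℕ)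
    (h : d s < n) (a : MvPowerSeries σ R) : coeff d (a * X s ^ n) = 0 :=
  X_pow_dvd_iff.mp (dvd_mul_left _ a) d h

/-- A power series in three variables lies in `(x, y, zⁿ)` as soon as its coefficients at
`1, z, …, zⁿ⁻¹` vanish. -/
theorem mem_span_of_coeff_eq_zero {k : Type*} [CommRing k] (n : ℕ) (p : MvPowerSeries (Fin 3) k)
    (h : ∀ i < n, coeff (Finsupp.single 2 i) p = 0) :
    p ∈ Ideal.span {(X 0 : MvPowerSeries (Fin 3) k), X 1, X 2 ^ n} := by
  classical
  let p₀ : MvPowerSeries (Fin 3) k := fun d ↦ if d 0 = 0 then 0 else coeff d p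
  let p₁ : MvPowerSeries (Fin 3) k := fun d ↦ if d 0 = 0 ∧ d 1 ≠ 0 then coeff d p else 0
  let p₂ : MvPowerSeries (Fin 3) k := fun d ↦ if d 0 = 0 ∧ d 1 = 0 then coeff d p else 0
  have hp₀ (d) : coeff d p₀ = if d 0 = 0 then 0 else coeff d p := rfl
  have hp₁ (d) : coeff d p₁ = if d 0 = 0 ∧ d 1 ≠ 0 then coeff d p else 0 := rfl
  have hp₂ (d) : coeff d p₂ = if d 0 = 0 ∧ d 1 = 0 then coeff d p else 0 := rfl
  have hp : p = p₀ + p₁ + p₂ := by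
    ext d
    rw [map_add, map_add, hp₀, hp₁, hp₂]
    by_cases h0 : d 0 = 0 <;> by_cases h1 : d 1 = 0 <;> simp [h0, h1]
  have d₀ : X 0 ∣ p₀ := X_dvd_iff.mpr fun d hd ↦ by rw [hp₀, if_pos hd]
  have d₁ : X 1 ∣ p₁ := X_dvd_iff.mpr fun d hd ↦ by rw [hp₁, if_neg (fun h ↦ h.2 hd)]
  have d₂ : X 2 ^ n ∣ p₂ := X_pow_dvd_iff.mpr fun d hd ↦ by
    rw [hp₂]
    split_ifs with hc
    · have : d = Finsupp.single 2 (d 2) := by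
        ext i
        fin_cases i <;> simp [hc.1, hc.2]
      rw [this]
      exact h _ hd
    · rfl
  rw [hp]
  refine add_mem (add_mem ?_ ?_) ?_
  · exact Ideal.mem_of_dvd _ d₀ (Ideal.subset_span (by simp))
  · exact Ideal.mem_of_dvd _ d₁ (Ideal.subset_span (by simp))
  · exact Ideal.mem_of_dvd _ d₂ (Ideal.subset_span (by simp))

/-- The ideal `(x, y, z)` of the power series ring in three variables is maximal. -/
theorem isMaximal_span_X {k : Type*} [Field k] :
    (Ideal.span {(X 0 : MvPowerSeries (Fin 3) k), X 1, X 2}).IsMaximal := by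
  have hmax : (RingHom.ker (constantCoeff (σ := Fin 3) (R := k))).IsMaximal :=
    RingHom.ker_isMaximal_of_surjective _ fun c ↦ ⟨C c, constantCoeff_C c⟩
  convert hmax
  refine le_antisymm ?_ ?_
  · rw [Ideal.span_le]
    rintro _ (rfl | rfl | rfl) <;> simp
  · intro p hp
    rw [← pow_one (X 2)]
    refine mem_span_of_coeff_eq_zero 1 p fun i hi ↦ ?_
    obtain rfl : i = 0 := by omega
    simpa using hp

/-- The ideal of power series of weighted order at least `n`. -/
def weightedOrderIdeal {σ : Type*} (R : Type*) [CommRing R] (w : σ → ℕ) (n : ℕ∞) :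
    Ideal (MvPowerSeries σ R) where
  carrier := {p | n ≤ p.weightedOrder w}
  zero_mem' := by simp
  add_mem' hp hq := (le_min hp hq).trans (min_weightedOrder_le_add w)
  smul_mem' a _ hp := le_trans (le_trans hp le_add_self) (le_weightedOrder_mul w)

theorem mem_weightedOrderIdeal {σ R : Type*} [CommRing R] {w : σ → ℕ} {n : ℕ∞}
    {p : MvPowerSeries σ R} : p ∈ weightedOrderIdeal R w n ↔ n ≤ p.weightedOrder w :=
  Iff.rfl

theorem weightedOrderIdeal_mul_le {σ R : Type*} [CommRing R] (w : σ → ℕ) (m n : ℕ∞) :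
    weightedOrderIdeal R w m * weightedOrderIdeal R w n ≤ weightedOrderIdeal R w (m + n) :=
  Ideal.mul_le.mpr fun _ hp _ hq ↦ (add_le_add hp hq).trans (le_weightedOrder_mul w)

theorem X_pow_mem_weightedOrderIdeal {σ R : Type*} [CommRing R] (w : σ → ℕ) (s : σ) (n m : ℕ)
    (h : m ≤ n * w s) : (X s : MvPowerSeries σ R) ^ n ∈ weightedOrderIdeal R w m := by
  classical
  rw [mem_weightedOrderIdeal]
  refine nat_le_weightedOrder w fun d hd ↦ ?_
  rw [coeff_X_pow, if_neg]
  rintro rfl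
  rw [Finsupp.weight_single, smul_eq_mul] at hd
  omega

/-- If `p x + q y + r z²` lies in `(x, y, z²)² + (x² + y³ + z⁶)` then `p`, `q` and `r` have
no terms in `1` and `z`. -/
theorem coeff_eq_zero_of_mem_sq_sup {k : Type*} [CommRing k] (p q r : MvPowerSeries (Fin 3) k)
    (h : p * X 0 + q * X 1 + r * X 2 ^ 2 ∈
      Ideal.span {(X 0 : MvPowerSeries (Fin 3) k), X 1, X 2 ^ 2} ^ 2 ⊔
        Ideal.span {(X 0 : MvPowerSeries (Fin 3) k) ^ 2 + X 1 ^ 3 + X 2 ^ 6})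
    (i : ℕ) (hi : i < 2) :
    coeff (Finsupp.single 2 i) p = 0 ∧ coeff (Finsupp.single 2 i) q = 0 ∧
      coeff (Finsupp.single 2 i) r = 0 := by
  let w : Fin 3 → ℕ := ![2, 2, 1]
  have hJ : Ideal.span {(X 0 : MvPowerSeries (Fin 3) k), X 1, X 2 ^ 2} ≤
      weightedOrderIdeal k w 2 := by
    rw [Ideal.span_le]
    rintro _ (rfl | rfl | rfl)
    · simpa using X_pow_mem_weightedOrderIdeal (R := k) w 0 1 2 (by simp [w])
    · simpa using X_pow_mem_weightedOrderIdeal (R := k) w 1 1 2 (by simp [w])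
    · exact X_pow_mem_weightedOrderIdeal w 2 2 2 (by simp [w])
  have hle : Ideal.span {(X 0 : MvPowerSeries (Fin 3) k), X 1, X 2 ^ 2} ^ 2 ⊔
      Ideal.span {(X 0 : MvPowerSeries (Fin 3) k) ^ 2 + X 1 ^ 3 + X 2 ^ 6} ≤
      weightedOrderIdeal k w (4 : ℕ) := by
    refine sup_le ?_ ?_
    · rw [pow_two]
      refine (Ideal.mul_mono hJ hJ).trans ((weightedOrderIdeal_mul_le w 2 2).trans_eq ?_)
      norm_num
    · rw [Ideal.span_singleton_le_iff_mem]
      exact add_mem (add_mem (X_pow_mem_weightedOrderIdeal w 0 2 4 (by simp [w]))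
        (X_pow_mem_weightedOrderIdeal w 1 3 4 (by simp [w])))
        (X_pow_mem_weightedOrderIdeal w 2 6 4 (by simp [w]))
  have hz (d : Fin 3 →₀ ℕ) (hd : Finsupp.weight w d < 4) :
      coeff d (p * X 0 ^ 1 + q * X 1 ^ 1 + r * X 2 ^ 2) = 0 := by
    rw [pow_one, pow_one]
    refine coeff_eq_zero_of_lt_weightedOrder w (lt_of_lt_of_le ?_ (hle h))
    exact_mod_cast hd
  have hw (s : Fin 3) (n : ℕ) (hn : i + n * w s < 4) :
      coeff (Finsupp.single 2 i + Finsupp.single s n)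
        (p * X 0 ^ 1 + q * X 1 ^ 1 + r * X 2 ^ 2) = 0 := by
    apply hz
    rw [map_add, Finsupp.weight_single, Finsupp.weight_single]
    simpa [w] using hn
  refine ⟨?_, ?_, ?_⟩
  · have := hw 0 1 (by simp [w]; omega)
    rwa [map_add, map_add, coeff_mul_X_pow_eq_zero _ 1 1 (by simp),
      coeff_mul_X_pow_eq_zero _ 2 2 (by simpa using hi), X_pow_eq, coeff_add_mul_monomial,
      mul_one, add_zero, add_zero] at this
  · have := hw 1 1 (by simp [w]; omega)
    rwa [map_add, map_add, coeff_mul_X_pow_eq_zero _ 0 1 (by simp),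
      coeff_mul_X_pow_eq_zero _ 2 2 (by simpa using hi), X_pow_eq, coeff_add_mul_monomial,
      mul_one, add_zero, zero_add] at this
  · have := hw 2 2 (by simp [w]; omega)
    rwa [map_add, map_add, coeff_mul_X_pow_eq_zero _ 0 1 (by simp),
      coeff_mul_X_pow_eq_zero _ 1 1 (by simp), X_pow_eq, coeff_add_mul_monomial,
      mul_one, zero_add, zero_add] at this

end MvPowerSeries

/-- If the only relations `a x + b y + c z ∈ I²` between generators `x, y, z` of `I` are those
with coefficients in `I`, then `I/I²` is free over `A/I`. -/
theorem Ideal.free_cotangent_of_span_triple {A : Type*} [CommRing A] (x y z : A) (I : Ideal A)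
    (hI : I = Ideal.span {x, y, z})
    (h : ∀ a b c : A, a * x + b * y + c * z ∈ I ^ 2 → a ∈ I ∧ b ∈ I ∧ c ∈ I) :
    Module.Free (A ⧸ I) I.Cotangent := by
  have hx : x ∈ I := hI ▸ Ideal.subset_span (by simp)
  have hy : y ∈ I := hI ▸ Ideal.subset_span (by simp)
  have hz : z ∈ I := hI ▸ Ideal.subset_span (by simp)
  let v : Fin 3 → I.Cotangent :=
    ![I.toCotangent ⟨x, hx⟩, I.toCotangent ⟨y, hy⟩, I.toCotangent ⟨z, hz⟩]
  have hcomb (a b c : A) (hmem : a * x + b * y + c * z ∈ I) :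
      Ideal.Quotient.mk I a • v 0 + Ideal.Quotient.mk I b • v 1 + Ideal.Quotient.mk I c • v 2 =
        I.toCotangent ⟨a * x + b * y + c * z, hmem⟩ := by
    change a • I.toCotangent ⟨x, hx⟩ + b • I.toCotangent ⟨y, hy⟩ + c • I.toCotangent ⟨z, hz⟩ = _
    rw [← map_smul, ← map_smul, ← map_smul, ← map_add, ← map_add]
    rfl
  refine Module.Free.of_basis (Module.Basis.mk (v := v) ?_ ?_)
  · rw [Fintype.linearIndependent_iff]
    intro g hg
    obtain ⟨a, ha⟩ := Ideal.Quotient.mk_surjective (g 0)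
    obtain ⟨b, hb⟩ := Ideal.Quotient.mk_surjective (g 1)
    obtain ⟨c, hc⟩ := Ideal.Quotient.mk_surjective (g 2)
    have hmem : a * x + b * y + c * z ∈ I :=
      add_mem (add_mem (I.mul_mem_left a hx) (I.mul_mem_left b hy)) (I.mul_mem_left c hz)
    rw [Fin.sum_univ_three, ← ha, ← hb, ← hc, hcomb a b c hmem, Ideal.toCotangent_eq_zero] at hg
    obtain ⟨h0, h1, h2⟩ := h a b c hg
    intro i
    fin_cases i
    · exact ha.symm.trans (Ideal.Quotient.eq_zero_iff_mem.mpr h0)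
    · exact hb.symm.trans (Ideal.Quotient.eq_zero_iff_mem.mpr h1)
    · exact hc.symm.trans (Ideal.Quotient.eq_zero_iff_mem.mpr h2)
  · rintro q -
    obtain ⟨⟨t, ht⟩, rfl⟩ := I.toCotangent_surjective q
    have ht' := ht
    rw [hI, Ideal.mem_span_insert] at ht'
    obtain ⟨a, _, hu, rfl⟩ := ht'
    obtain ⟨b, c, rfl⟩ := Ideal.mem_span_pair.mp hu
    have : a * x + (b * y + c * z) = a * x + b * y + c * z := by ring
    simp only [this]
    rw [← hcomb a b c (this ▸ ht)]
    have hv (i : Fin 3) : v i ∈ Submodule.span (A ⧸ I) (Set.range v) :=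
      Submodule.subset_span ⟨i, rfl⟩
    exact add_mem (add_mem (Submodule.smul_mem _ _ (hv 0)) (Submodule.smul_mem _ _ (hv 1)))
      (Submodule.smul_mem _ _ (hv 2))

/-- If `x² + y³ + z⁶ = 0` then `(x, y, z²)² = (y, z²)(x, y, z²)`. -/
theorem span_sq_eq_span_mul_span {A : Type*} [CommRing A] {x y z : A}
    (h : x ^ 2 + y ^ 3 + z ^ 6 = 0) :
    Ideal.span {x, y, z ^ 2} ^ 2 = Ideal.span {y, z ^ 2} * Ideal.span {x, y, z ^ 2} := by
  have hQI : Ideal.span {y, z ^ 2} ≤ Ideal.span {x, y, z ^ 2} :=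
    Ideal.span_mono (Set.subset_insert _ _)
  refine le_antisymm ?_ (pow_two (Ideal.span {x, y, z ^ 2}) ▸ Ideal.mul_mono_left hQI)
  have hy : y ∈ Ideal.span {y, z ^ 2} := Ideal.subset_span (by simp)
  have hz : z ^ 2 ∈ Ideal.span {y, z ^ 2} := Ideal.subset_span (by simp)
  have hx : x ∈ Ideal.span {x, y, z ^ 2} := Ideal.subset_span (by simp)
  have hxx : x * x ∈ Ideal.span {y, z ^ 2} * Ideal.span {x, y, z ^ 2} := by
    rw [show x * x = y * (-y * y) + z ^ 2 * (-z ^ 2 * z ^ 2) by linear_combination h]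
    exact add_mem (Ideal.mul_mem_mul hy (Ideal.mul_mem_left _ _ (hQI hy)))
      (Ideal.mul_mem_mul hz (Ideal.mul_mem_left _ _ (hQI hz)))
  rw [pow_two, Ideal.span_mul_span', Ideal.span_le]
  rintro _ ⟨a, (rfl | rfl | rfl), b, (rfl | rfl | rfl), rfl⟩
  · exact hxx
  · exact Ideal.mul_mem_mul_rev hy hx
  · exact Ideal.mul_mem_mul_rev hz hx
  · exact Ideal.mul_mem_mul hy hx
  · exact Ideal.mul_mem_mul hy (hQI hy)
  · exact Ideal.mul_mem_mul hy (hQI hz)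
  · exact Ideal.mul_mem_mul hz hx
  · exact Ideal.mul_mem_mul hz (hQI hy)
  · exact Ideal.mul_mem_mul hz (hQI hz)


open MvPowerSeries in
/-- Let `A = k[[x,y,z]]/(x² + y³ + z⁶)`, `k` algebraically closed of
characteristic `0`. Then `I = (x, y, z²)` is an Ulrich ideal of colength `2` with
minimal reduction `Q = (y, z²)`: `I² = QI`, `ℓ_A(A/I) = 2` and `ℓ_A(A/Q) = 4`. -/
theorem statement6 (k : Type*) [Field k] [IsAlgClosed k] [CharZero k]
    (A : Type*) [CommRing A] (π : MvPowerSeries (Fin 3) k →+* A)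
    (hA : Function.Surjective π)
    (hker : RingHom.ker π =
      Ideal.span {(X 0 : MvPowerSeries (Fin 3) k) ^ 2 + X 1 ^ 3 + X 2 ^ 6})
    (I Q : Ideal A)
    (hI : I = Ideal.span {π (X 0), π (X 1), π (X 2) ^ 2})
    (hQ : Q = Ideal.span {π (X 1), π (X 2) ^ 2}) :
    IsMinimalReduction2 Q I ∧ I ^ 2 = Q * I ∧ Module.Free (A ⧸ I) I.Cotangent ∧
      moduleLength A (A ⧸ I) = (2 : WithBot ℕ∞) ∧
      moduleLength A (A ⧸ Q) = (4 : WithBot ℕ∞) := by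
  set x := π (X 0) with hx
  set y := π (X 1) with hy
  set z := π (X 2) with hz
  have hrel : x ^ 2 + y ^ 3 + z ^ 6 = 0 := by
    have : (X 0 : MvPowerSeries (Fin 3) k) ^ 2 + X 1 ^ 3 + X 2 ^ 6 ∈ RingHom.ker π :=
      hker ▸ Ideal.mem_span_singleton_self _
    simpa [RingHom.mem_ker] using this
  have hcomap (J : Ideal (MvPowerSeries (Fin 3) k)) (p : MvPowerSeries (Fin 3) k)
      (hp : π p ∈ J.map π) :
      p ∈ J ⊔ Ideal.span {(X 0 : MvPowerSeries (Fin 3) k) ^ 2 + X 1 ^ 3 + X 2 ^ 6} := by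
    rw [← hker, ← Ideal.comap_map_of_surjective' π hA]
    exact hp
  have hImap : I = (Ideal.span {(X 0 : MvPowerSeries (Fin 3) k), X 1, X 2 ^ 2}).map π := by
    rw [hI, Ideal.map_span]
    simp [Set.image_insert_eq, hx, hy, hz]
  have hsq : I ^ 2 = Q * I := by
    rw [hI, hQ]
    exact span_sq_eq_span_mul_span hrel
  have hQI : Q ≤ I := by
    rw [hI, hQ]
    exact Ideal.span_mono (Set.subset_insert _ _)
  have hfree : Module.Free (A ⧸ I) I.Cotangent := by
    refine Ideal.free_cotangent_of_span_triple _ _ _ I hI fun a b c habc ↦ ?_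
    obtain ⟨p, rfl⟩ := hA a
    obtain ⟨q, rfl⟩ := hA b
    obtain ⟨r, rfl⟩ := hA c
    rw [hImap, ← Ideal.map_pow, hx, hy, hz, ← map_pow, ← map_mul, ← map_mul, ← map_mul,
      ← map_add, ← map_add] at habc
    have hcoeff := coeff_eq_zero_of_mem_sq_sup p q r (hcomap _ _ habc)
    rw [hImap]
    exact ⟨Ideal.mem_map_of_mem π (mem_span_of_coeff_eq_zero 2 p fun i hi ↦ (hcoeff i hi).1),
      Ideal.mem_map_of_mem π (mem_span_of_coeff_eq_zero 2 q fun i hi ↦ (hcoeff i hi).2.1),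
      Ideal.mem_map_of_mem π (mem_span_of_coeff_eq_zero 2 r fun i hi ↦ (hcoeff i hi).2.2)⟩
  -- Membership in `A` of an ideal containing the relation is detected by coefficients.
  have hnotMem (S : Set (MvPowerSeries (Fin 3) k)) (p : MvPowerSeries (Fin 3) k)
      (d : Fin 3 →₀ ℕ) (hp : coeff d p ≠ 0) (hS : ∀ g ∈ S, ∀ a, coeff d (a * g) = 0)
      (h0 : d 0 < 2) (h1 : d 1 < 3) (h2 : d 2 < 6) : π p ∉ Ideal.span (Set.image π S) := by
    intro hmem
    rw [← Ideal.map_span] at hmem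
    have := hcomap _ _ hmem
    rw [← Ideal.span_union] at this
    refine hp (coeff_eq_zero_of_mem_span d ?_ this)
    rintro g (hg | rfl) a
    · exact hS g hg a
    · rw [mul_add, mul_add, map_add, map_add, coeff_mul_X_pow_eq_zero d 0 2 h0,
        coeff_mul_X_pow_eq_zero d 1 3 h1, coeff_mul_X_pow_eq_zero d 2 6 h2, add_zero, add_zero]
  have hX (d : Fin 3 →₀ ℕ) (s : Fin 3) (hd : d s = 0) (a : MvPowerSeries (Fin 3) k) :
      coeff d (a * X s) = 0 := by
    simpa using coeff_mul_X_pow_eq_zero d s 1 (by omega) a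
  let m : Ideal A := Ideal.span {x, y, z}
  have h_one : (1 : A) ∉ Ideal.span {z, x, y, z ^ 2} := by
    have := hnotMem {X 2, X 0, X 1, X 2 ^ 2} 1 0 (by simp) (by
      rintro _ (rfl | rfl | rfl | rfl) a
      · exact hX 0 2 rfl a
      · exact hX 0 0 rfl a
      · exact hX 0 1 rfl a
      · exact coeff_mul_X_pow_eq_zero 0 2 2 (by simp) a) (by simp) (by simp) (by simp)
    simpa [Set.image_insert_eq] using this
  have h_z : z ∉ Ideal.span {x, y, z ^ 2} := by
    have := hnotMem {X 0, X 1, X 2 ^ 2} (X 2) (Finsupp.single 2 1) (by simp [coeff_X]) (by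
      rintro _ (rfl | rfl | rfl) a
      · exact hX _ 0 (by simp) a
      · exact hX _ 1 (by simp) a
      · exact coeff_mul_X_pow_eq_zero _ 2 2 (by simp) a) (by simp) (by simp) (by simp)
    simpa [Set.image_insert_eq] using this
  have h_x : x ∉ Ideal.span {x * z, y, z ^ 2} := by
    have := hnotMem {X 0 * X 2, X 1, X 2 ^ 2} (X 0) (Finsupp.single 0 1) (by simp [coeff_X]) (by
      rintro _ (rfl | rfl | rfl) a
      · rw [← mul_assoc]
        exact hX _ 2 (by simp) _
      · exact hX _ 1 (by simp) a
      · exact coeff_mul_X_pow_eq_zero _ 2 2 (by simp) a) (by simp) (by simp) (by simp)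
    simpa [Set.image_insert_eq] using this
  have h_xz : x * z ∉ Ideal.span {y, z ^ 2} := by
    have := hnotMem {X 1, X 2 ^ 2} (X 0 * X 2) (Finsupp.single 0 1 + Finsupp.single 2 1)
      (by simp [X, monomial_mul_monomial]) (by
      rintro _ (rfl | rfl) a
      · exact hX _ 1 (by simp) a
      · exact coeff_mul_X_pow_eq_zero _ 2 2 (by simp) a) (by simp) (by simp) (by simp)
    simpa [Set.image_insert_eq] using this
  have hmax : m.IsMaximal := by
    have hmap : m = (Ideal.span {(X 0 : MvPowerSeries (Fin 3) k), X 1, X 2}).map π := by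
      simp [m, Ideal.map_span, Set.image_insert_eq, hx, hy, hz]
    have := Ideal.map_eq_top_or_isMaximal_of_surjective π hA (isMaximal_span_X (k := k))
    rw [← hmap] at this
    refine this.resolve_left fun htop ↦ h_one ?_
    have hle : m ≤ Ideal.span {z, x, y, z ^ 2} := Ideal.span_mono (by
      rintro _ (rfl | rfl | rfl) <;> simp)
    exact hle (htop ▸ Submodule.mem_top)
  have hmul (S : Set A) (g : A) (h0 : x * g ∈ Ideal.span S) (h1 : y * g ∈ Ideal.span S)
      (h2 : z * g ∈ Ideal.span S) : m * Ideal.span {g} ≤ Ideal.span S := by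
    rw [Ideal.span_mul_span', Ideal.span_le]
    rintro _ ⟨_, (rfl | rfl | rfl), _, rfl, rfl⟩ <;> assumption
  have hgen {S : Set A} {g : A} (a : A) (hg : g ∈ S) : a * g ∈ Ideal.span S :=
    Ideal.mul_mem_left _ a (Ideal.subset_span hg)
  have hlenI : Module.length A (A ⧸ I) = 2 := by
    rw [hI, Ideal.length_quotient_span_insert m _ z h_z (hmul _ _
      (mul_comm z x ▸ hgen z (by simp)) (mul_comm z y ▸ hgen z (by simp))
      (pow_two z ▸ Ideal.subset_span (by simp))),
      Ideal.length_quotient_span_insert m _ 1 h_one (hmul _ _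
      (mul_one x ▸ Ideal.subset_span (by simp)) (mul_one y ▸ Ideal.subset_span (by simp))
      (mul_one z ▸ Ideal.subset_span (by simp)))]
    have htop : Ideal.span (insert 1 {z, x, y, z ^ 2}) = (⊤ : Ideal A) :=
      (Ideal.eq_top_iff_one _).mpr (Ideal.subset_span (by simp))
    have : Subsingleton (A ⧸ Ideal.span (insert 1 {z, x, y, z ^ 2})) :=
      Ideal.Quotient.subsingleton_iff.mpr htop
    rw [Module.length_eq_zero]
    norm_num
  have hlenQ : Module.length A (A ⧸ Q) = 4 := by
    have hsup : Ideal.span {x, x * z, y, z ^ 2} = I := by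
      rw [hI]
      refine le_antisymm (Ideal.span_le.mpr ?_) (Ideal.span_mono ?_)
      · rintro _ (rfl | rfl | rfl | rfl)
        · exact Ideal.subset_span (by simp)
        · exact mul_comm z x ▸ hgen z (by simp)
        · exact Ideal.subset_span (by simp)
        · exact Ideal.subset_span (by simp)
      · rintro _ (rfl | rfl | rfl) <;> simp
    have hxx (a : A) (S : Set A) (h1 : y ∈ S) (h2 : z ^ 2 ∈ S) : a * x ^ 2 ∈ Ideal.span S := by
      have : a * x ^ 2 = -a * y ^ 2 * y + -a * z ^ 4 * z ^ 2 := by linear_combination a * hrel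
      rw [this]
      exact add_mem (hgen _ h1) (hgen _ h2)
    rw [hQ, Ideal.length_quotient_span_insert m _ (x * z) h_xz (hmul _ _
      (by
        rw [show x * (x * z) = z * x ^ 2 by ring]
        exact hxx z _ (by simp) (by simp))
      (by
        rw [mul_comm]
        exact hgen _ (by simp))
      (by
        rw [show z * (x * z) = x * z ^ 2 by ring]
        exact hgen _ (by simp))),
      Ideal.length_quotient_span_insert m _ x h_x (hmul _ _
      (by
        rw [show x * x = 1 * x ^ 2 by ring]
        exact hxx 1 _ (by simp) (by simp))
      (by
        rw [mul_comm y x]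
        exact hgen _ (by simp))
      (by
        rw [mul_comm z x]
        exact Ideal.subset_span (by simp))), hsup, hlenI]
    norm_num
  refine ⟨⟨⟨hQI, 1, ?_⟩, _, _, hQ⟩, hsq, hfree, ?_, ?_⟩
  · rw [pow_one]
    exact hsq
  · rw [moduleLength, ← Module.coe_length, hlenI]
    rfl
  · rw [moduleLength, ← Module.coe_length, hlenQ]
    rfl
end
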